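/- arXiv:1804.01943 — 7 statements merged into one kernel-verified Lean document; each statement's English description precedes it below -/
import Mathlib

section
/- Let M be a monoid, A ⊆ M a subset, A' := Set.centralizer A its commutant, and A'' := Set.centralizer A' its double commutant. Define the relation r on M by: r s t holds iff s ∈ A'', t ∈ A'', and there exist b, b' ∈ A' with b * s = b' * t. If s, s̃, t, t̃ ∈ A'' satisfy EqvGen r s s̃ and EqvGen r t t̃, then EqvGen r (s * t) (s̃ * t̃). (Well-posedness of the composition of equivalence classes of transformations of a subsystem.) -/
/-- The equivalence-generating relation on transformations: `s` and `t` (both in the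
double commutant `A''`) are related iff they can be degraded to a common transformation
by elements of the commutant `A'`. -/
def relTransf {M : Type*} [Monoid M] (A : Set M) (s t : M) : Prop :=
  s ∈ Set.centralizer (Set.centralizer A) ∧
  t ∈ Set.centralizer (Set.centralizer A) ∧
  ∃ b ∈ Set.centralizer A, ∃ b' ∈ Set.centralizer A, b * s = b' * t

theorem relTransf.mul_right {M : Type*} [Monoid M] {A : Set M} {s t x : M}
    (hx : x ∈ Set.centralizer (Set.centralizer A)) (h : relTransf A s t) :
    relTransf A (s * x) (t * x) := by
  obtain ⟨hs, ht, b, hb, b', hb', h⟩ := h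
  exact ⟨Set.mul_mem_centralizer hs hx, Set.mul_mem_centralizer ht hx, b, hb, b', hb', by
    rw [← mul_assoc, h, mul_assoc]⟩

theorem relTransf.mul_left {M : Type*} [Monoid M] {A : Set M} {s t x : M}
    (hx : x ∈ Set.centralizer (Set.centralizer A)) (h : relTransf A s t) :
    relTransf A (x * s) (x * t) := by
  obtain ⟨hs, ht, b, hb, b', hb', h⟩ := h
  exact ⟨Set.mul_mem_centralizer hx hs, Set.mul_mem_centralizer hx ht, b, hb, b', hb', by
    rw [← mul_assoc, hx b hb, mul_assoc, h, ← mul_assoc, ← hx b' hb', mul_assoc]⟩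

theorem Relation.EqvGen.map_of_forall {α β : Type*} {r : α → α → Prop} {p : β → β → Prop}
    {f : α → β} (hf : ∀ a b, r a b → p (f a) (f b)) {a b : α} (h : Relation.EqvGen r a b) :
    Relation.EqvGen p (f a) (f b) := by
  induction h with
  | rel a b h => exact .rel _ _ (hf a b h)
  | refl a => exact .refl _
  | symm a b _ ih => exact .symm _ _ ih
  | trans a b c _ _ ih₁ ih₂ => exact .trans _ _ _ ih₁ ih₂

/-- Well-posedness of the composition of equivalence classes of transformations of a
subsystem. -/
theorem composition_well_posed {M : Type*} [Monoid M] (A : Set M)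
    (s s' t t' : M)
    (hs : s ∈ Set.centralizer (Set.centralizer A))
    (hs' : s' ∈ Set.centralizer (Set.centralizer A))
    (ht : t ∈ Set.centralizer (Set.centralizer A))
    (ht' : t' ∈ Set.centralizer (Set.centralizer A))
    (h1 : Relation.EqvGen (relTransf A) s s')
    (h2 : Relation.EqvGen (relTransf A) t t') :
    Relation.EqvGen (relTransf A) (s * t) (s' * t') := by
  exact .trans _ (s' * t) _
    (h1.map_of_forall (f := (· * t)) fun _ _ h => h.mul_right ht)
    (h2.map_of_forall (f := (s' * ·)) fun _ _ h => h.mul_left hs')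
end

section
/- Let M be a monoid acting on a set X (a MulAction), A ⊆ M a subset, B := Set.centralizer A, and A'' := Set.centralizer B. Define the relation rT on M by: rT s t holds iff s ∈ A'', t ∈ A'', and there exist b, b' ∈ B with b * s = b' * t; and the relation rX on X by: rX ψ φ holds iff there exist b, b' ∈ B with b • ψ = b' • φ. If t, t̃ ∈ A'' satisfy EqvGen rT t t̃ and ψ, ψ' ∈ X satisfy EqvGen rX ψ ψ', then EqvGen rX (t • ψ) (t̃ • ψ'). (Well-posedness of the action of transformations of a subsystem on its states.) -/
/-- The equivalence-generating relation on transformations: `s` and `t` (both in the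
double commutant `A''`) are related iff they can be degraded to a common transformation
by elements of the commutant `B = A'`. -/
def relT {M : Type*} [Monoid M] (A : Set M) (s t : M) : Prop :=
  s ∈ Set.centralizer (Set.centralizer A) ∧
  t ∈ Set.centralizer (Set.centralizer A) ∧
  ∃ b ∈ Set.centralizer A, ∃ b' ∈ Set.centralizer A, b * s = b' * t

/-- The equivalence-generating relation on states: `ψ` and `φ` are related iff they can
be degraded to a common state by elements of the commutant `B = A'`. -/
def relX {M X : Type*} [Monoid M] [MulAction M X] (A : Set M) (ψ φ : X) : Prop :=
  ∃ b ∈ Set.centralizer A, ∃ b' ∈ Set.centralizer A, b • ψ = b' • φ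

theorem relX.smul_of_relT {M X : Type*} [Monoid M] [MulAction M X] {A : Set M} {s t : M}
    (h : relT A s t) (ψ : X) : relX A (s • ψ) (t • ψ) := by
  obtain ⟨-, -, b, hb, b', hb', e⟩ := h
  exact ⟨b, hb, b', hb', by rw [← mul_smul, ← mul_smul, e]⟩

theorem relX.smul {M X : Type*} [Monoid M] [MulAction M X] {A : Set M} {t : M}
    (ht : t ∈ Set.centralizer (Set.centralizer A)) {ψ φ : X} (h : relX A ψ φ) :
    relX A (t • ψ) (t • φ) := by
  obtain ⟨b, hb, b', hb', e⟩ := h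
  refine ⟨b, hb, b', hb', ?_⟩
  rw [← mul_smul, ← mul_smul, ht b hb, ht b' hb', mul_smul, mul_smul, e]

theorem eqvGen_relX_smul_of_relT {M X : Type*} [Monoid M] [MulAction M X] {A : Set M}
    {s t : M} (h : Relation.EqvGen (relT A) s t) (ψ : X) :
    Relation.EqvGen (relX A) (s • ψ) (t • ψ) := by
  induction h with
  | rel _ _ h => exact .rel _ _ (.smul_of_relT h ψ)
  | refl _ => exact .refl _
  | symm _ _ _ ih => exact .symm _ _ ih
  | trans _ _ _ _ _ ih₁ ih₂ => exact .trans _ _ _ ih₁ ih₂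

theorem eqvGen_relX_smul {M X : Type*} [Monoid M] [MulAction M X] {A : Set M} {t : M}
    (ht : t ∈ Set.centralizer (Set.centralizer A)) {ψ φ : X}
    (h : Relation.EqvGen (relX A) ψ φ) :
    Relation.EqvGen (relX A) (t • ψ) (t • φ) := by
  induction h with
  | rel _ _ h => exact .rel _ _ (.smul ht h)
  | refl _ => exact .refl _
  | symm _ _ _ ih => exact .symm _ _ ih
  | trans _ _ _ _ _ ih₁ ih₂ => exact .trans _ _ _ ih₁ ih₂

/-- Well-posedness of the action of transformations of a subsystem on its states. -/
theorem action_well_posed {M X : Type*} [Monoid M] [MulAction M X] (A : Set M)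
    (t t' : M)
    (ht : t ∈ Set.centralizer (Set.centralizer A))
    (ht' : t' ∈ Set.centralizer (Set.centralizer A))
    (hT : Relation.EqvGen (relT A) t t')
    (ψ ψ' : X)
    (hX : Relation.EqvGen (relX (M := M) A) ψ ψ') :
    Relation.EqvGen (relX (M := M) A) (t • ψ) (t' • ψ') :=
  .trans _ _ _ (eqvGen_relX_smul_of_relT hT ψ) (eqvGen_relX_smul ht' hX)
end

section
/- Let a and b be nonempty finite types with decidable equality, and let ρ, σ : Matrix (a × b) (a × b) ℂ be density matrices. A local channel on the b factor is a map 𝓝 : Matrix (a × b) (a × b) ℂ → Matrix (a × b) (a × b) ℂ for which there exist r : ℕ and B : Fin r → Matrix b b ℂ with ∑ i, (B i)ᴴ * (B i) = 1 and 𝓝 X = ∑ i, ((1 : Matrix a a ℂ) ⊗ₖ B i) * X * ((1 : Matrix a a ℂ) ⊗ₖ B i)ᴴ for all X. Define the relation rel by: rel ρ σ holds iff there exist local channels 𝓝, 𝓝' on the b factor with 𝓝 ρ = 𝓝' σ. Then EqvGen rel ρ σ holds if and only if the partial traces over b coincide, i.e. for all x, x' : a, ∑ y : b, ρ (x, y)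 (x', y) = ∑ y : b, σ (x, y) (x', y). -/
open Matrix Kronecker ComplexOrder

/-- A local channel on the `b` factor of a bipartite system `a × b`: a quantum channel
whose Kraus operators are of the form `1 ⊗ₖ B i`. -/
def IsLocalChannelB {a b : Type*} [Fintype a] [Fintype b] [DecidableEq a] [DecidableEq b]
    (𝓝 : Matrix (a × b) (a × b) ℂ → Matrix (a × b) (a × b) ℂ) : Prop :=
  ∃ (r : ℕ) (B : Fin r → Matrix b b ℂ),
    (∑ i, (B i)ᴴ * B i = 1) ∧
    ∀ X, 𝓝 X = ∑ i, ((1 : Matrix a a ℂ) ⊗ₖ B i) * X * ((1 : Matrix a a ℂ) ⊗ₖ B i)ᴴ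

/-- The `(x, x')` block of a matrix on `a × b`. -/
def bipartiteBlock {a b : Type*} (X : Matrix (a × b) (a × b) ℂ) (x x' : a) : Matrix b b ℂ :=
  X.submatrix (Prod.mk x) (Prod.mk x')

lemma bipartiteBlock_one_kronecker_conj {a b : Type*} [Fintype a] [Fintype b] [DecidableEq a]
    (B : Matrix b b ℂ) (X : Matrix (a × b) (a × b) ℂ) (x x' : a) :
    bipartiteBlock (((1 : Matrix a a ℂ) ⊗ₖ B) * X * ((1 : Matrix a a ℂ) ⊗ₖ B)ᴴ) x x' =
      B * bipartiteBlock X x x' * Bᴴ := by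
  ext y y'
  simp [bipartiteBlock, Matrix.mul_apply, Fintype.sum_prod_type, Matrix.one_apply,
    Finset.sum_ite_irrel, apply_ite (starRingEnd ℂ)]

lemma bipartiteBlock_sum {a b ι : Type*} [Fintype ι] (X : ι → Matrix (a × b) (a × b) ℂ)
    (x x' : a) : bipartiteBlock (∑ i, X i) x x' = ∑ i, bipartiteBlock (X i) x x' := by
  ext y y'
  simp [bipartiteBlock, Matrix.sum_apply]

/-- Local channels on the second factor preserve the partial trace over that factor. -/
lemma IsLocalChannelB.trace_bipartiteBlock {a b : Type*} [Fintype a] [Fintype b] [DecidableEq a]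
    [DecidableEq b] {N : Matrix (a × b) (a × b) ℂ → Matrix (a × b) (a × b) ℂ}
    (hN : IsLocalChannelB N) (X : Matrix (a × b) (a × b) ℂ) (x x' : a) :
    (bipartiteBlock (N X) x x').trace = (bipartiteBlock X x x').trace := by
  obtain ⟨r, B, hB, hN⟩ := hN
  simp_rw [hN, bipartiteBlock_sum, bipartiteBlock_one_kronecker_conj, Matrix.trace_sum,
    Matrix.trace_mul_cycle (B _)]
  rw [← Matrix.trace_sum, ← Finset.sum_mul, hB, one_mul]

/-- The channel resetting the second factor to a fixed basis state. -/
lemma exists_isLocalChannelB_reset {a b : Type*} [Fintype a] [Fintype b] [DecidableEq a]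
    [DecidableEq b] (y₀ : b) :
    ∃ N : Matrix (a × b) (a × b) ℂ → Matrix (a × b) (a × b) ℂ, IsLocalChannelB N ∧
      ∀ X x x', bipartiteBlock (N X) x x' =
        Matrix.single y₀ y₀ (bipartiteBlock X x x').trace := by
  let e := Fintype.equivFin b
  refine ⟨_, ⟨_, fun i => Matrix.single y₀ (e.symm i) 1, ?_, fun X => rfl⟩, fun X x x' => ?_⟩
  · rw [e.symm.sum_comp fun j => (Matrix.single y₀ j (1 : ℂ))ᴴ * Matrix.single y₀ j 1]
    simp [Matrix.conjTranspose_single, Matrix.sum_single_one]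
  · simp_rw [bipartiteBlock_sum, bipartiteBlock_one_kronecker_conj]
    rw [e.symm.sum_comp fun j => Matrix.single y₀ j (1 : ℂ) * bipartiteBlock X x x' *
      (Matrix.single y₀ j 1)ᴴ]
    ext y y'
    simp [Matrix.conjTranspose_single, Matrix.single_mul_mul_single, Matrix.sum_apply,
      Matrix.single_apply, Matrix.trace, Finset.sum_ite_irrel]

/-- Two states of a bipartite quantum system are equivalent for the agent acting on the
first factor (i.e. connected by the equivalence relation generated by degradation under
local channels on the second factor) iff they have the same partial trace over the
second factor. -/
theorem equivalent_iff_same_partial_trace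
    {a b : Type*} [Fintype a] [Fintype b] [DecidableEq a] [DecidableEq b]
    [Nonempty a] [Nonempty b]
    (ρ σ : Matrix (a × b) (a × b) ℂ)
    (hρ : ρ.PosSemidef) (hρtr : ρ.trace = 1)
    (hσ : σ.PosSemidef) (hσtr : σ.trace = 1)
    (rel : Matrix (a × b) (a × b) ℂ → Matrix (a × b) (a × b) ℂ → Prop)
    (hrel : ∀ X Y, rel X Y ↔
      ∃ 𝓝 𝓝', IsLocalChannelB 𝓝 ∧ IsLocalChannelB 𝓝' ∧ 𝓝 X = 𝓝' Y) :
    Relation.EqvGen rel ρ σ ↔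
      ∀ x x' : a, ∑ y : b, ρ (x, y) (x', y) = ∑ y : b, σ (x, y) (x', y) := by
  change _ ↔ ∀ x x', (bipartiteBlock ρ x x').trace = (bipartiteBlock σ x x').trace
  constructor
  · intro h x x'
    clear hρ hρtr hσ hσtr
    induction h with
    | rel X Y h =>
      obtain ⟨N, N', hN, hN', h⟩ := (hrel X Y).1 h
      rw [← hN.trace_bipartiteBlock, h, hN'.trace_bipartiteBlock]
    | refl X => rfl
    | symm X Y _ ih => exact ih.symm
    | trans X Y Z _ _ ih₁ ih₂ => exact ih₁.trans ih₂
  · intro h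
    obtain ⟨N, hN, hreset⟩ := exists_isLocalChannelB_reset (a := a) (Classical.arbitrary b)
    refine .rel _ _ ((hrel ρ σ).2 ⟨N, N, hN, hN, ?_⟩)
    ext ⟨x, y⟩ ⟨x', y'⟩
    change bipartiteBlock (N ρ) x x' y y' = bipartiteBlock (N σ) x x' y y'
    rw [hreset, hreset, h]
end

section
/- Let a and b be nonempty finite types with decidable equality. Let 𝓒 be a quantum channel on Matrix (a × b) (a × b) ℂ, i.e. 𝓒 X = ∑ i, C i * X * (C i)ᴴ for some finite family C : Fin r → Matrix (a × b) (a × b) ℂ with ∑ i, (C i)ᴴ * (C i) = 1. A local channel on the a factor is a map 𝓜 of the form 𝓜 X = ∑ i, (A i ⊗ₖ (1 : Matrix b b ℂ)) * X * (A i ⊗ₖ (1 : Matrix b b ℂ))ᴴ with A : Fin s → Matrix a a ℂ and ∑ i, (A i)ᴴ * (A i) = 1. If 𝓒 ∘ 𝓜 = 𝓜 ∘ 𝓒 for every local channel 𝓜 on the a factor, then there exist t : ℕ and B : Fin t → Matrix b b ℂ with ∑ j, (B j)ᴴ * (B j) = 1 such that 𝓒 X = ∑ j, ((1 : Matrix a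 a ℂ) ⊗ₖ B j) * X * ((1 : Matrix a a ℂ) ⊗ₖ B j)ᴴ for all X. (The commutant of the local channels on one tensor factor consists of the local channels on the other factor.) -/
open Matrix Kronecker

/-- A local channel on the `a` factor of a bipartite system `a × b`: a quantum channel
whose Kraus operators are of the form `A i ⊗ₖ 1`. -/
def IsLocalChannelA {a b : Type*} [Fintype a] [Fintype b] [DecidableEq a] [DecidableEq b]
    (𝓜 : Matrix (a × b) (a × b) ℂ → Matrix (a × b) (a × b) ℂ) : Prop :=
  ∃ (s : ℕ) (A : Fin s → Matrix a a ℂ),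
    (∑ i, (A i)ᴴ * A i = 1) ∧
    ∀ X, 𝓜 X = ∑ i, (A i ⊗ₖ (1 : Matrix b b ℂ)) * X * (A i ⊗ₖ (1 : Matrix b b ℂ))ᴴ

/-- A finite sum of matrices `Z i * (Z i)ᴴ` vanishes only if every `Z i` does. -/
theorem Matrix.eq_zero_of_sum_mul_conjTranspose_self_eq_zero {ι m n : Type*} [Fintype ι]
    [Fintype m] [Fintype n] {Z : ι → Matrix m n ℂ} (h : ∑ i, Z i * (Z i)ᴴ = 0) (i : ι) :
    Z i = 0 := by
  open scoped ComplexOrder in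
  have htr : ∑ i, (Z i * (Z i)ᴴ).trace = 0 := by rw [← trace_sum, h, trace_zero]
  have hnn : ∀ i ∈ Finset.univ, 0 ≤ (Z i * (Z i)ᴴ).trace := fun i _ =>
    (posSemidef_self_mul_conjTranspose (Z i)).trace_nonneg
  exact trace_mul_conjTranspose_self_eq_zero_iff.1
    ((Finset.sum_eq_zero_iff_of_nonneg hnn).1 htr i (Finset.mem_univ i))

/-- A matrix for which every unit vector is an eigenvector is a scalar matrix. -/
theorem Matrix.exists_eq_smul_one_of_forall_unit_eigenvector {a : Type*} [Fintype a]
    [DecidableEq a] [Nonempty a] (M : Matrix a a ℂ)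
    (h : ∀ ψ : a → ℂ, star ψ ⬝ᵥ ψ = 1 → ∃ c : ℂ, M *ᵥ ψ = c • ψ) :
    ∃ c : ℂ, M = c • 1 := by
  have hoff : ∀ x k, x ≠ k → M x k = 0 := by
    intro x k hxk
    obtain ⟨c, hc⟩ := h (Pi.single k 1) (by simp)
    simpa [hxk] using congrFun hc x
  have hdiag : ∀ k l, M k k = M l l := by
    intro k l
    by_cases hkl : k = l
    · rw [hkl]
    have hlk : l ≠ k := Ne.symm hkl
    obtain ⟨c, hc⟩ := h (Pi.single k (3 / 5) + Pi.single l (4 / 5)) (by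
      rw [dotProduct_add, dotProduct_single, dotProduct_single]
      simp [hkl, hlk]
      norm_num)
    have hk : M k k = c := by
      have := congrFun hc k
      simp [mulVec_add, hoff k l hkl, hkl] at this
      linear_combination 5 / 3 * this
    have hl : M l l = c := by
      have := congrFun hc l
      simp [mulVec_add, hoff l k hlk, hlk] at this
      linear_combination 5 / 4 * this
    rw [hk, hl]
  obtain ⟨k₀⟩ := ‹Nonempty a›
  refine ⟨M k₀ k₀, ?_⟩
  ext x y
  by_cases hxy : x = y
  · subst hxy
    simp [hdiag x k₀]
  · simp [hxy, hoff x y hxy]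

/-- A family of Kraus operators representing the channel that replaces the state of the `a`
factor by the pure state `ψ` is trace preserving. -/
theorem sum_replacement_kraus {a : Type*} [Fintype a] [DecidableEq a] {ψ : a → ℂ}
    (hψ : star ψ ⬝ᵥ ψ = 1) :
    ∑ k : a, (vecMulVec ψ (Pi.single k (1 : ℂ)))ᴴ * vecMulVec ψ (Pi.single k (1 : ℂ)) = 1 := by
  simp only [conjTranspose_vecMulVec, vecMulVec_mul_vecMulVec, hψ, one_smul]
  ext x y
  simp [Matrix.sum_apply, vecMulVec_apply, Pi.single_apply, Matrix.one_apply]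

theorem sum_replacement_apply_pure {a : Type*} [Fintype a] [DecidableEq a] {ψ : a → ℂ}
    (hψ : star ψ ⬝ᵥ ψ = 1) :
    ∑ k, vecMulVec ψ (Pi.single k (1 : ℂ)) * vecMulVec ψ (star ψ) *
      (vecMulVec ψ (Pi.single k (1 : ℂ)))ᴴ = vecMulVec ψ (star ψ) := by
  have hψ' : ∑ k, ψ k * star (ψ k) = 1 := by
    simpa [dotProduct, mul_comm] using hψ
  ext x y
  simp only [conjTranspose_vecMulVec, vecMulVec_mul_vecMulVec, Matrix.sum_apply]
  calc _ = ∑ k, (ψ k * star (ψ k)) * (ψ x * star (ψ y)) :=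
        Finset.sum_congr rfl fun k _ => by
          simp [vecMulVec_apply]; ring
    _ = _ := by rw [← Finset.sum_mul, hψ', one_mul]; rfl

theorem pure_projection_mul_self {a : Type*} [Fintype a] {ψ : a → ℂ}
    (hψ : star ψ ⬝ᵥ ψ = 1) :
    vecMulVec ψ (star ψ) * vecMulVec ψ (star ψ) = vecMulVec ψ (star ψ) := by
  rw [vecMulVec_mul_vecMulVec, hψ, one_smul]

/-- Multiplication by operators on the `a` factor acts blockwise on the `(β, β')` blocks. -/
theorem kronecker_one_mul_mul_kronecker_one_apply {a b : Type*} [Fintype a] [Fintype b]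
    [DecidableEq b] (P Q : Matrix a a ℂ) (D : Matrix (a × b) (a × b) ℂ) (x y : a) (β β' : b) :
    ((Q ⊗ₖ (1 : Matrix b b ℂ)) * D * (P ⊗ₖ (1 : Matrix b b ℂ))) (x, β) (y, β') =
      (Q * D.submatrix (·, β) (·, β') * P) x y := by
  simp [Matrix.mul_apply, Fintype.sum_prod_type, Matrix.one_apply]

/-- The Kraus operators of a channel commuting with all local channels on the `a` factor map
`ψ ⊗ v` to `ψ ⊗ w` for some `w`. -/
theorem kraus_compl_mul_kraus_mul_pure_eq_zero {a b : Type*} [Fintype a] [Fintype b]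
    [DecidableEq a] [DecidableEq b]
    {𝓒 : Matrix (a × b) (a × b) ℂ → Matrix (a × b) (a × b) ℂ}
    {r : ℕ} {C : Fin r → Matrix (a × b) (a × b) ℂ} (hC : ∀ X, 𝓒 X = ∑ i, C i * X * (C i)ᴴ)
    (hcomm : ∀ 𝓜, IsLocalChannelA 𝓜 → 𝓒 ∘ 𝓜 = 𝓜 ∘ 𝓒)
    {ψ : a → ℂ} (hψ : star ψ ⬝ᵥ ψ = 1) (i : Fin r) :
    ((1 - vecMulVec ψ (star ψ)) ⊗ₖ (1 : Matrix b b ℂ)) * C i *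
      (vecMulVec ψ (star ψ) ⊗ₖ (1 : Matrix b b ℂ)) = 0 := by
  set P := vecMulVec ψ (star ψ) with hP
  have hPP : P * P = P := pure_projection_mul_self hψ
  have hPH : Pᴴ = P := by simp [hP, conjTranspose_vecMulVec]
  set Q := (1 - P) ⊗ₖ (1 : Matrix b b ℂ) with hQ
  let A : a → Matrix a a ℂ := fun k => vecMulVec ψ (Pi.single k 1)
  let 𝓜 : Matrix (a × b) (a × b) ℂ → Matrix (a × b) (a × b) ℂ := fun X =>
    ∑ k, (A k ⊗ₖ (1 : Matrix b b ℂ)) * X * (A k ⊗ₖ (1 : Matrix b b ℂ))ᴴ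
  have hloc : IsLocalChannelA 𝓜 := by
    refine ⟨Fintype.card a, A ∘ (Fintype.equivFin a).symm, ?_, fun X => ?_⟩
    · rw [← sum_replacement_kraus hψ]
      exact (Fintype.equivFin a).symm.sum_comp fun k => (A k)ᴴ * A k
    · exact ((Fintype.equivFin a).symm.sum_comp fun k =>
        (A k ⊗ₖ (1 : Matrix b b ℂ)) * X * (A k ⊗ₖ (1 : Matrix b b ℂ))ᴴ).symm
  have hfix : 𝓜 (P ⊗ₖ 1) = P ⊗ₖ 1 := by
    have hsum : ∀ F : a → Matrix a a ℂ,
        ∑ k, F k ⊗ₖ (1 : Matrix b b ℂ) = (∑ k, F k) ⊗ₖ 1 := fun F => by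
      ext; simp [Matrix.sum_apply, Finset.sum_mul]
    simp only [𝓜, conjTranspose_kronecker, conjTranspose_one, ← mul_kronecker_mul, mul_one]
    rw [hsum, sum_replacement_apply_pure hψ]
  have hkill : ∀ Y, Q * 𝓜 Y = 0 := by
    intro Y
    simp only [𝓜, Finset.mul_sum, ← mul_assoc, hQ, ← mul_kronecker_mul]
    refine Finset.sum_eq_zero fun k _ => ?_
    have : (1 - P) * A k = 0 := by
      simp [A, hP, sub_mul, vecMulVec_mul_vecMulVec, hψ]
    simp [this]
  have hout : 𝓒 (P ⊗ₖ 1) = 𝓜 (𝓒 (P ⊗ₖ 1)) := by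
    have := congrFun (hcomm 𝓜 hloc) (P ⊗ₖ 1)
    rwa [Function.comp_apply, Function.comp_apply, hfix] at this
  have hzero : Q * 𝓒 (P ⊗ₖ 1) * Qᴴ = 0 := by rw [hout, hkill, zero_mul]
  refine eq_zero_of_sum_mul_conjTranspose_self_eq_zero
    (Z := fun i => Q * C i * (P ⊗ₖ (1 : Matrix b b ℂ))) ?_ i
  rw [← hzero, hC, Finset.mul_sum, Finset.sum_mul]
  refine Finset.sum_congr rfl fun j _ => ?_
  have hsplit : (P ⊗ₖ (1 : Matrix b b ℂ)) * (P ⊗ₖ (1 : Matrix b b ℂ))ᴴ = P ⊗ₖ 1 := by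
    rw [conjTranspose_kronecker, conjTranspose_one, hPH, ← mul_kronecker_mul, hPP, mul_one]
  conv_rhs => rw [← hsplit]
  simp only [conjTranspose_mul, mul_assoc]

/-- The Kraus operators of a channel commuting with all local channels on the `a` factor act
trivially on the `a` factor. -/
theorem exists_kraus_eq_one_kronecker {a b : Type*} [Fintype a] [Fintype b]
    [DecidableEq a] [DecidableEq b] [Nonempty a]
    {𝓒 : Matrix (a × b) (a × b) ℂ → Matrix (a × b) (a × b) ℂ}
    {r : ℕ} {C : Fin r → Matrix (a × b) (a × b) ℂ} (hC : ∀ X, 𝓒 X = ∑ i, C i * X * (C i)ᴴ)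
    (hcomm : ∀ 𝓜, IsLocalChannelA 𝓜 → 𝓒 ∘ 𝓜 = 𝓜 ∘ 𝓒) (i : Fin r) :
    ∃ B : Matrix b b ℂ, C i = (1 : Matrix a a ℂ) ⊗ₖ B := by
  have hblock : ∀ β β', ∃ c : ℂ, (C i).submatrix (·, β) (·, β') = c • (1 : Matrix a a ℂ) := by
    intro β β'
    refine exists_eq_smul_one_of_forall_unit_eigenvector _ fun ψ hψ => ?_
    set M := (C i).submatrix (·, β) (·, β')
    have hz : (1 - vecMulVec ψ (star ψ)) * M * vecMulVec ψ (star ψ) = 0 := by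
      ext x y
      rw [← kronecker_one_mul_mul_kronecker_one_apply,
        kraus_compl_mul_kraus_mul_pure_eq_zero hC hcomm hψ i]
      rfl
    have hv := congrArg (· *ᵥ ψ) hz
    simp only [← mulVec_mulVec, vecMulVec_mulVec, hψ, zero_mulVec, sub_mulVec,
      one_mulVec] at hv
    refine ⟨star ψ ⬝ᵥ M *ᵥ ψ, ?_⟩
    simpa [sub_eq_zero] using hv
  choose B hB using hblock
  refine ⟨of B, ?_⟩
  ext ⟨x, β⟩ ⟨y, β'⟩
  simpa [mul_comm] using congrFun (congrFun (hB β β') x) y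

/-- The commutant of the local channels on one tensor factor consists of the local
channels on the other factor: a quantum channel commuting with all local channels on
the `a` factor has a Kraus representation by operators of the form `1 ⊗ₖ B j`. -/
theorem commutant_of_local_channels
    {a b : Type*} [Fintype a] [Fintype b] [DecidableEq a] [DecidableEq b]
    [Nonempty a] [Nonempty b]
    (𝓒 : Matrix (a × b) (a × b) ℂ → Matrix (a × b) (a × b) ℂ)
    (h𝓒 : ∃ (r : ℕ) (C : Fin r → Matrix (a × b) (a × b) ℂ),
      (∑ i, (C i)ᴴ * C i = 1) ∧ ∀ X, 𝓒 X = ∑ i, C i * X * (C i)ᴴ)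
    (hcomm : ∀ 𝓜, IsLocalChannelA 𝓜 → 𝓒 ∘ 𝓜 = 𝓜 ∘ 𝓒) :
    ∃ (t : ℕ) (B : Fin t → Matrix b b ℂ),
      (∑ j, (B j)ᴴ * B j = 1) ∧
      ∀ X, 𝓒 X = ∑ j, ((1 : Matrix a a ℂ) ⊗ₖ B j) * X * ((1 : Matrix a a ℂ) ⊗ₖ B j)ᴴ := by
  obtain ⟨r, C, hC1, hC⟩ := h𝓒
  choose B hB using exists_kraus_eq_one_kronecker hC hcomm
  refine ⟨r, B, ?_, fun X => ?_⟩
  · obtain ⟨k⟩ := ‹Nonempty a›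
    simp only [hB, conjTranspose_kronecker, conjTranspose_one, ← mul_kronecker_mul,
      mul_one] at hC1
    ext β β'
    have h := congrFun (congrFun hC1 (k, β)) (k, β')
    simpa [Matrix.sum_apply, Matrix.one_apply] using h
  · simp only [hC, hB]
end

section
/- Let M be a monoid acting on a set X (a MulAction) and let N be a submonoid of M that is regular, meaning: (i) for all ψ, ψ' ∈ X, if there exist u, u' ∈ N with u • ψ = u' • ψ', then there exists w ∈ N with ψ' = w • ψ or ψ = w • ψ'; and (ii) for all v, v' ∈ N there exists w ∈ N with v = w * v' or v' = w * v. Define the relation rel on X by: rel ψ φ holds iff there exist u, u' ∈ N with u • ψ = u' • φ. Then for all ψ, ψ' ∈ X, EqvGen rel ψ ψ' implies that there exists v ∈ N with ψ' = v • ψ or ψ = v • ψ'. (For a regular monoid of adversarial actions, equivalence of states is witnessed by a single transformation; this yields the essential uniqueness of purification.) -/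
/-- For a regular monoid `N` of adversarial actions, equivalence of states (the
equivalence relation generated by degradation under `N`) is witnessed by a single
transformation. -/
theorem regular_monoid_single_witness {M X : Type*} [Monoid M] [MulAction M X]
    (N : Submonoid M)
    (reg1 : ∀ ψ ψ' : X, (∃ u ∈ N, ∃ u' ∈ N, u • ψ = u' • ψ') →
      ∃ w ∈ N, ψ' = w • ψ ∨ ψ = w • ψ')
    (reg2 : ∀ v ∈ N, ∀ v' ∈ N, ∃ w ∈ N, v = w * v' ∨ v' = w * v)
    (rel : X → X → Prop)
    (hrel : ∀ ψ φ, rel ψ φ ↔ ∃ u ∈ N, ∃ u' ∈ N, u • ψ = u' • φ)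
    (ψ ψ' : X) (h : Relation.EqvGen rel ψ ψ') :
    ∃ v ∈ N, ψ' = v • ψ ∨ ψ = v • ψ' := by
  induction h with
  | rel a b hab => exact reg1 a b ((hrel a b).1 hab)
  | refl a => exact ⟨1, N.one_mem, Or.inl (one_smul M a).symm⟩
  | symm a b _ ih =>
    obtain ⟨v, hv, h⟩ := ih
    exact ⟨v, hv, h.symm⟩
  | trans a b c _ _ ihab ihbc =>
    obtain ⟨v, hv, hab | hab⟩ := ihab <;> obtain ⟨w, hw, hbc | hbc⟩ := ihbc
    · exact ⟨w * v, N.mul_mem hw hv, Or.inl (by rw [hbc, hab, mul_smul])⟩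
    · exact reg1 a c ⟨v, hv, w, hw, hab.symm.trans hbc⟩
    · obtain ⟨x, hx, h | h⟩ := reg2 v hv w hw
      · exact ⟨x, hx, Or.inr (by rw [hab, hbc, h, mul_smul])⟩
      · exact ⟨x, hx, Or.inl (by rw [hab, hbc, h, mul_smul])⟩
    · exact ⟨v * w, N.mul_mem hv hw, Or.inr (by rw [hab, hbc, mul_smul])⟩
end

section
/- Let H be a complex Hilbert space (a complete inner product space over ℂ) that is separable. Then for every pair of linear isometries V, V' : H →ₗᵢ[ℂ] H there exists a linear isometry W : H →ₗᵢ[ℂ] H such that W ∘ V = V' or W ∘ V' = V. (The monoid of isometric channels on a separable Hilbert space satisfies the second regularity condition.) -/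
/-- An embedding of the index types of Hilbert bases induces a linear isometry. -/
theorem HilbertBasis.nonempty_linearIsometry {𝕜 E F ι ι' : Type*} [RCLike 𝕜]
    [NormedAddCommGroup E] [InnerProductSpace 𝕜 E]
    [NormedAddCommGroup F] [InnerProductSpace 𝕜 F] [CompleteSpace F]
    (b : HilbertBasis ι 𝕜 E) (b' : HilbertBasis ι' 𝕜 F) (f : ι ↪ ι') :
    Nonempty (E →ₗᵢ[𝕜] F) :=
  ⟨(b'.orthonormal.comp f f.injective).orthogonalFamily.linearIsometry.comp
    b.repr.toLinearIsometry⟩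

/-- Of two Hilbert spaces, one embeds isometrically into the other. -/
theorem nonempty_linearIsometry_or {𝕜 E F : Type*} [RCLike 𝕜]
    [NormedAddCommGroup E] [InnerProductSpace 𝕜 E] [CompleteSpace E]
    [NormedAddCommGroup F] [InnerProductSpace 𝕜 F] [CompleteSpace F] :
    Nonempty (E →ₗᵢ[𝕜] F) ∨ Nonempty (F →ₗᵢ[𝕜] E) := by
  obtain ⟨w, b, -⟩ := exists_hilbertBasis 𝕜 E
  obtain ⟨w', b', -⟩ := exists_hilbertBasis 𝕜 F
  exact (Function.Embedding.total w w').imp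
    (fun ⟨f⟩ => b.nonempty_linearIsometry b' f) (fun ⟨f⟩ => b'.nonempty_linearIsometry b f)

/-- An isometry between the orthogonal complements of the ranges of two isometries `V` and `V'`
allows one to factor `V'` through `V`. -/
theorem LinearIsometry.exists_comp_eq {𝕜 E F G : Type*} [RCLike 𝕜]
    [NormedAddCommGroup E] [InnerProductSpace 𝕜 E] [CompleteSpace E]
    [NormedAddCommGroup F] [InnerProductSpace 𝕜 F]
    [NormedAddCommGroup G] [InnerProductSpace 𝕜 G]
    (V : E →ₗᵢ[𝕜] F) (V' : E →ₗᵢ[𝕜] G)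
    (J : (LinearMap.range V.toLinearMap)ᗮ →ₗᵢ[𝕜] (LinearMap.range V'.toLinearMap)ᗮ) :
    ∃ W : F →ₗᵢ[𝕜] G, W.comp V = V' := by
  set R := LinearMap.range V.toLinearMap
  let e : E ≃ₗᵢ[𝕜] R := V.equivRange
  have : CompleteSpace R := e.symm.toIsometryEquiv.completeSpace
  let M : F →ₗ[𝕜] G :=
    V'.toLinearMap ∘ₗ e.symm.toLinearEquiv.toLinearMap ∘ₗ R.orthogonalProjectionOnto.toLinearMap +
      (Submodule.subtype _) ∘ₗ J.toLinearMap ∘ₗ Rᗮ.orthogonalProjectionOnto.toLinearMap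
  have hM (x : F) : M x = V' (e.symm (R.orthogonalProjectionOnto x)) +
      J (Rᗮ.orthogonalProjectionOnto x) := rfl
  refine ⟨⟨M, fun x => ?_⟩, ?_⟩
  · have orth : inner 𝕜 (V' (e.symm (R.orthogonalProjectionOnto x)))
        (J (Rᗮ.orthogonalProjectionOnto x) : G) = 0 :=
      Submodule.inner_right_of_mem_orthogonal (LinearMap.mem_range_self V'.toLinearMap _)
        (J _).2
    rw [← sq_eq_sq₀ (norm_nonneg _) (norm_nonneg _),
      Submodule.norm_sq_eq_add_norm_sq_projection x R, hM, sq,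
      norm_add_sq_eq_norm_sq_add_norm_sq_of_inner_eq_zero _ _ orth, V'.norm_map,
      e.symm.norm_map, Submodule.norm_coe, J.norm_map, sq, sq]
  · ext x
    have hP : R.orthogonalProjectionOnto (V x) = e x :=
      R.orthogonalProjectionOnto_mem_subspace_eq_self (e x)
    have hQ : Rᗮ.orthogonalProjectionOnto (V x) = 0 :=
      R.orthogonalProjectionOnto_orthogonal_apply_eq_zero (e x).2
    change M (V x) = V' x
    rw [hM, hP, hQ]
    simp

/-- The monoid of isometries on a separable complex Hilbert space satisfies the second
regularity condition: any two isometries are related by left composition with a third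
isometry. -/
theorem isometries_regular {H : Type*} [NormedAddCommGroup H] [InnerProductSpace ℂ H]
    [CompleteSpace H] [TopologicalSpace.SeparableSpace H]
    (V V' : H →ₗᵢ[ℂ] H) :
    ∃ W : H →ₗᵢ[ℂ] H, W.comp V = V' ∨ W.comp V' = V := by
  rcases nonempty_linearIsometry_or (𝕜 := ℂ) (E := (LinearMap.range V.toLinearMap)ᗮ)
    (F := (LinearMap.range V'.toLinearMap)ᗮ) with ⟨⟨J⟩⟩ | ⟨⟨J⟩⟩
  · obtain ⟨W, hW⟩ := V.exists_comp_eq V' J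
    exact ⟨W, .inl hW⟩
  · obtain ⟨W, hW⟩ := V'.exists_comp_eq V J
    exact ⟨W, .inr hW⟩
end

section
/- Let ι be a finite type and, for each j : ι, let R j and M j be nonempty finite types with decidable equality. Let ψ, ψ' : (Σ j : ι, R j × M j) → ℂ be unit vectors (∑ x, ‖ψ x‖² = 1 and likewise for ψ') such that for every j : ι and all r, r' : R j, ∑ m : M j, ψ ⟨j, (r, m)⟩ * star (ψ ⟨j, (r', m)⟩) = ∑ m : M j, ψ' ⟨j, (r, m)⟩ * star (ψ' ⟨j, (r', m)⟩). Then there exists a family of unitary matrices U j ∈ Matrix.unitaryGroup (M j) ℂ such that for every j : ι, r : R j and m : M j, ψ' ⟨j, (r, m)⟩ = ∑ m' : M j, ψ ⟨j, (r, m')⟩ * (U j : Matrix (M j) (M j) ℂ) m' m. (Two pure states of ⊕_j (R_j ⊗ M_j) with the same partial trace over the multiplicity spaces are related by a unitary of the block form ⊕_j (I_{R_j} ⊗ U_j).) -/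
/-- Two families of vectors with the same Gram matrix in a finite-dimensional inner product space
are related by a linear isometry of the whole space. -/
theorem exists_linearIsometry_apply_eq_of_inner_eq {𝕜 V κ : Type*} [RCLike 𝕜]
    [NormedAddCommGroup V] [InnerProductSpace 𝕜 V] [FiniteDimensional 𝕜 V] (v w : κ → V)
    (h : ∀ i j, inner 𝕜 (v i) (v j) = inner 𝕜 (w i) (w j)) :
    ∃ L : V →ₗᵢ[𝕜] V, ∀ i, L (v i) = w i := by
  set A := Finsupp.linearCombination 𝕜 v with hA
  set B := Finsupp.linearCombination 𝕜 w with hB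
  have hnorm : ∀ c, ‖B c‖ = ‖A c‖ := by
    intro c
    have hinner : inner 𝕜 (B c) (B c) = inner 𝕜 (A c) (A c) := by
      simp only [hA, hB, Finsupp.linearCombination_apply, Finsupp.sum_inner, Finsupp.inner_sum,
        inner_smul_left, inner_smul_right, h]
    rw [@norm_eq_sqrt_re_inner 𝕜, @norm_eq_sqrt_re_inner 𝕜, hinner]
  obtain ⟨g, hg⟩ := A.rangeRestrict.exists_rightInverse_of_surjective A.range_rangeRestrict
  have hAg : ∀ s, A (g s) = s := fun s => congrArg Subtype.val (LinearMap.congr_fun hg s)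
  let L₀ : LinearMap.range A →ₗᵢ[𝕜] V :=
    { toLinearMap := B ∘ₗ g
      norm_map' := fun s => by
        rw [LinearMap.comp_apply, hnorm, hAg, Submodule.coe_norm] }
  refine ⟨L₀.extend, fun i => ?_⟩
  have hAi : A (Finsupp.single i 1) = v i := by simp [hA]
  have hBi : B (Finsupp.single i 1) = w i := by simp [hB]
  let s : LinearMap.range A := ⟨v i, _, hAi⟩
  have hL : L₀.extend (v i) = B (g s) := L₀.extend_apply s
  rw [hL, ← hBi, ← sub_eq_zero, ← map_sub, ← norm_eq_zero, hnorm, map_sub, hAg, hAi]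
  simp [s]

open scoped Matrix in
/-- Two complex matrices `X`, `Y` with `X Xᴴ = Y Yᴴ` satisfy `Y = X U` for some unitary `U`. -/
theorem Matrix.exists_unitary_mul_eq_of_mul_conjTranspose_eq {κ n : Type*} [Fintype n]
    [DecidableEq n] (X Y : Matrix κ n ℂ) (h : X * Xᴴ = Y * Yᴴ) :
    ∃ U : Matrix.unitaryGroup n ℂ, Y = X * (U : Matrix n n ℂ) := by
  obtain ⟨L, hL⟩ := exists_linearIsometry_apply_eq_of_inner_eq (𝕜 := ℂ)
    (fun i => WithLp.toLp 2 (X i)) (fun i => WithLp.toLp 2 (Y i)) (fun i j => by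
      simpa [Matrix.mul_apply, PiLp.inner_apply] using congrFun (congrFun h j) i)
  let b := EuclideanSpace.basisFun n ℂ
  let E := L.toLinearIsometryEquiv rfl
  refine ⟨⟨(E.toMatrix b.toBasis b.toBasis)ᵀ,
    Matrix.transpose_mem_unitaryGroup_iff.mpr (E.toMatrix_mem_unitaryGroup b b)⟩, ?_⟩
  ext i m
  have hm := congrFun (LinearMap.toMatrix_mulVec_repr b.toBasis b.toBasis
    E.toLinearEquiv.toLinearMap (WithLp.toLp 2 (X i))) m
  have hE : E (WithLp.toLp 2 (X i)) = WithLp.toLp 2 (Y i) := hL i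
  simp [Matrix.mulVec, dotProduct, b, hE] at hm
  simp [Matrix.mul_apply, b, ← hm, mul_comm]


/-- Two pure states of `⊕_j (R_j ⊗ M_j)` with the same partial trace over the
multiplicity spaces `M_j` are related by a unitary of the block form
`⊕_j (I_{R_j} ⊗ U_j)`. -/
theorem same_partial_trace_implies_local_unitary
    {ι : Type*} [Fintype ι] (R Mu : ι → Type*)
    [∀ j, Fintype (R j)] [∀ j, Fintype (Mu j)]
    [∀ j, Nonempty (R j)] [∀ j, Nonempty (Mu j)]
    [∀ j, DecidableEq (R j)] [∀ j, DecidableEq (Mu j)]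
    (ψ ψ' : (Σ j : ι, R j × Mu j) → ℂ)
    (hψ : ∑ x, ‖ψ x‖ ^ 2 = 1) (hψ' : ∑ x, ‖ψ' x‖ ^ 2 = 1)
    (h : ∀ (j : ι) (r r' : R j),
      ∑ m : Mu j, ψ ⟨j, (r, m)⟩ * star (ψ ⟨j, (r', m)⟩) =
      ∑ m : Mu j, ψ' ⟨j, (r, m)⟩ * star (ψ' ⟨j, (r', m)⟩)) :
    ∃ U : ∀ j, Matrix.unitaryGroup (Mu j) ℂ,
      ∀ (j : ι) (r : R j) (m : Mu j),
        ψ' ⟨j, (r, m)⟩ =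
          ∑ m' : Mu j, ψ ⟨j, (r, m')⟩ * (U j : Matrix (Mu j) (Mu j) ℂ) m' m := by
  have key : ∀ j, ∃ U : Matrix.unitaryGroup (Mu j) ℂ,
      (Matrix.of fun r m => ψ' ⟨j, (r, m)⟩) =
        (Matrix.of fun r m => ψ ⟨j, (r, m)⟩) * (U : Matrix (Mu j) (Mu j) ℂ) := fun j =>
    Matrix.exists_unitary_mul_eq_of_mul_conjTranspose_eq _ _ (by
      ext r r'
      simpa [Matrix.mul_apply] using h j r r')
  choose U hU using key
  refine ⟨U, fun j r m => ?_⟩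
  simpa [Matrix.mul_apply] using congrFun (congrFun (hU j) r) m
end
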